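/- arXiv:2012.01681 — 7 statements merged into one kernel-verified Lean document; each statement's English description precedes it below -/
import Mathlib

section
/- Let p be a prime. For every prime ℓ ≠ p, let M_ℓ be a finitely generated module over the ring ℤ_ℓ of ℓ-adic integers and let F_ℓ : M_ℓ → M_ℓ be a ℤ_ℓ-linear automorphism. Assume the family is a compatible system, i.e. there exists a polynomial P ∈ ℤ[T] with P(1) ≠ 0 such that for every ℓ ≠ p and every x ∈ M_ℓ, the element ((F_ℓ − 1) ∘ P(F_ℓ))(x) is annihilated by some power of ℓ. Let f_ℓ : ker(F_ℓ − 1) → M_ℓ/(F_ℓ − 1)M_ℓ be the map given by composing the inclusion ker(F_ℓ − 1) ⊆ M_ℓ with the quotient map. Then f_ℓ has finite kernel and finite cokernel for every ℓ ≠ p, and for all but finitely many primes ℓ the kernel and cokernel of f_ℓ have the same (finite) cardinality. -/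
/-- The map from invariants to coinvariants of an endomorphism `θ`,
induced by the identity: `ker θ → M ⧸ range θ`. Applied with `θ = F - 1`,
this is the map `f : ker (F - 1) → M ⧸ (F - 1) M` induced by the identity of `M`. -/
noncomputable def invToCoinv {R : Type} [CommRing R] {M : Type} [AddCommGroup M]
    [Module R M] (θ : Module.End R M) :
    LinearMap.ker θ →ₗ[R] M ⧸ LinearMap.range θ :=
  (LinearMap.range θ).mkQ.comp (LinearMap.ker θ).subtype

open scoped nonZeroDivisors

theorem padicInt_hasFiniteQuotients (ℓ : ℕ) [Fact ℓ.Prime] : Ring.HasFiniteQuotients ℤ_[ℓ] where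
  finiteQuotient := by
    intro I hI
    obtain ⟨n, rfl⟩ := PadicInt.ideal_eq_span_pow_p hI
    have : NeZero (ℓ ^ n) := ⟨pow_ne_zero n (Fact.out : ℓ.Prime).ne_zero⟩
    rw [← PadicInt.ker_toZModPow]
    exact Finite.of_injective _ (RingHom.kerLift_injective (PadicInt.toZModPow n))

section InvToCoinv

variable {R : Type} [CommRing R] {M : Type} [AddCommGroup M] [Module R M]

/-- For a linear endomorphism of a finite module, invariants and coinvariants have the same
cardinality. -/
theorem card_ker_eq_card_quotient_range [Finite M] (θ : Module.End R M) :
    Nat.card (LinearMap.ker θ) = Nat.card (M ⧸ LinearMap.range θ) := by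
  have h₁ := Submodule.card_eq_card_quotient_mul_card (LinearMap.ker θ)
  have h₂ := Submodule.card_eq_card_quotient_mul_card (LinearMap.range θ)
  rw [Nat.card_congr θ.quotKerEquivRange.toEquiv] at h₁
  have hpos : 0 < Nat.card (LinearMap.range θ) := Nat.card_pos
  refine Nat.eq_of_mul_eq_mul_left hpos ?_
  linarith

theorem mem_ker_invToCoinv {θ : Module.End R M} {x : LinearMap.ker θ} :
    x ∈ LinearMap.ker (invToCoinv θ) ↔ (x : M) ∈ LinearMap.range θ := by
  simp [invToCoinv]

theorem mk_mem_range_invToCoinv {θ : Module.End R M} {x : M} :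
    (LinearMap.range θ).mkQ x ∈ LinearMap.range (invToCoinv θ) ↔
      ∃ k ∈ LinearMap.ker θ, ∃ y, x = k + θ y := by
  constructor
  · rintro ⟨k, hk⟩
    have hk' : (LinearMap.range θ).mkQ (k : M) = (LinearMap.range θ).mkQ x := hk
    rw [Submodule.mkQ_apply, Submodule.mkQ_apply, eq_comm, Submodule.Quotient.eq] at hk'
    obtain ⟨y, hy⟩ := hk'
    exact ⟨k, k.2, y, by rw [hy]; abel⟩
  · rintro ⟨k, hk, y, rfl⟩
    refine ⟨⟨k, hk⟩, ?_⟩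
    simp [invToCoinv]

variable [IsDomain R]

theorem Module.IsTorsion.finite [Ring.HasFiniteQuotients R] [Module.Finite R M]
    (h : Module.IsTorsion R M) : Finite M := by
  obtain ⟨a, ha, ha0⟩ := Submodule.annihilator_top_inter_nonZeroDivisors h
  have hI : (⊤ : Submodule R M).annihilator ≠ ⊥ := by
    intro hbot
    rw [hbot] at ha
    exact nonZeroDivisors.ne_zero ha0 ha
  have := Ring.HasFiniteQuotients.finiteQuotient hI
  have hfin := Submodule.finite_quotient_smul (⊤ : Submodule R M).annihilator
    (Module.Finite.fg_top (R := R) (M := M))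
  rw [Submodule.annihilator_smul] at hfin
  exact Finite.of_equiv _ (Submodule.quotEquivOfEqBot (⊥ : Submodule R M) rfl).toEquiv

theorem mem_torsion_of_smul_mem_torsion {a : R} (ha : a ≠ 0) {x : M}
    (h : a • x ∈ Submodule.torsion R M) : x ∈ Submodule.torsion R M := by
  rw [Submodule.mem_torsion_iff] at h ⊢
  obtain ⟨b, hb⟩ := h
  refine ⟨b * ⟨a, mem_nonZeroDivisors_of_ne_zero ha⟩, ?_⟩
  rw [mul_smul]
  exact hb

variable {θ Q : Module.End R M} {c : R}

/-- The hypothesis says that `θ` is annihilated, up to torsion, by `X * (c + X * q(X))`. -/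
theorem mem_torsion_of_apply_apply_eq_zero (hc : c ≠ 0) (hQ : Commute θ Q)
    (h : ∀ x, θ (c • x + θ (Q x)) ∈ Submodule.torsion R M) {x : M}
    (hx : θ (θ x) = 0) : θ x ∈ Submodule.torsion R M := by
  have hcomm : ∀ y, θ (Q y) = Q (θ y) := fun y ↦ LinearMap.congr_fun hQ.eq y
  have := h x
  rw [map_add, map_smul, hcomm, hcomm, hx, map_zero, add_zero] at this
  exact mem_torsion_of_smul_mem_torsion hc this

theorem finite_ker_invToCoinv [Ring.HasFiniteQuotients R] [Module.Finite R M]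
    (hc : c ≠ 0) (hQ : Commute θ Q)
    (h : ∀ x, θ (c • x + θ (Q x)) ∈ Submodule.torsion R M) :
    Finite (LinearMap.ker (invToCoinv θ)) := by
  refine Module.IsTorsion.finite (R := R) fun x ↦ ?_
  obtain ⟨⟨x, hx⟩, hx'⟩ := x
  obtain ⟨y, rfl⟩ := mem_ker_invToCoinv.1 hx'
  obtain ⟨a, ha⟩ := (Submodule.mem_torsion_iff _).1
    (mem_torsion_of_apply_apply_eq_zero hc hQ h hx)
  exact ⟨a, Subtype.ext (Subtype.ext ha)⟩

theorem finite_coker_invToCoinv [Ring.HasFiniteQuotients R] [Module.Finite R M]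
    (hc : c ≠ 0) (h : ∀ x, θ (c • x + θ (Q x)) ∈ Submodule.torsion R M) :
    Finite ((M ⧸ LinearMap.range θ) ⧸ LinearMap.range (invToCoinv θ)) := by
  refine Module.IsTorsion.finite (R := R) fun {x} ↦ ?_
  obtain ⟨x, rfl⟩ := Submodule.mkQ_surjective _ x
  obtain ⟨x, rfl⟩ := Submodule.mkQ_surjective _ x
  obtain ⟨a, ha⟩ := (Submodule.mem_torsion_iff _).1 (h x)
  refine ⟨a * ⟨c, mem_nonZeroDivisors_of_ne_zero hc⟩, ?_⟩
  rw [Submonoid.smul_def, Submonoid.coe_mul, ← map_smul, ← map_smul, Submodule.mkQ_apply, Submodule.Quotient.mk_eq_zero,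
    mk_mem_range_invToCoinv]
  refine ⟨(a : R) • (c • x + θ (Q x)), ?_, -((a : R) • Q x), ?_⟩
  · rw [LinearMap.mem_ker, map_smul]
    exact ha
  · rw [map_neg, map_smul, smul_add, mul_smul]
    abel

theorem card_ker_invToCoinv_eq_card_coker [Ring.HasFiniteQuotients R] [Module.Finite R M]
    (hc : IsUnit c) (hQ : Commute θ Q)
    (h : ∀ x, θ (c • x + θ (Q x)) ∈ Submodule.torsion R M) :
    Nat.card (LinearMap.ker (invToCoinv θ)) =
      Nat.card ((M ⧸ LinearMap.range θ) ⧸ LinearMap.range (invToCoinv θ)) := by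
  let T : Submodule R M := LinearMap.range θ ⊓ Submodule.torsion R M
  have hTfin : Finite T := by
    refine Module.IsTorsion.finite (R := R) fun {x} ↦ ?_
    obtain ⟨a, ha⟩ := (Submodule.mem_torsion_iff _).1 x.2.2
    exact ⟨a, Subtype.ext ha⟩
  have hθtors : ∀ x ∈ Submodule.torsion R M, θ x ∈ Submodule.torsion R M := by
    intro x hx
    obtain ⟨a, ha⟩ := (Submodule.mem_torsion_iff _).1 hx
    refine (Submodule.mem_torsion_iff _).2 ⟨a, ?_⟩
    change (a : R) • θ x = 0
    rw [← map_smul]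
    exact (congrArg θ ha).trans (map_zero θ)
  let θT : Module.End R T :=
    θ.restrict (p := T) (q := T) fun x hx ↦ ⟨⟨x, rfl⟩, hθtors x hx.2⟩
  have hker : Nat.card (LinearMap.ker (invToCoinv θ)) = Nat.card (LinearMap.ker θT) := by
    refine Nat.card_congr
      { toFun := fun x ↦ ⟨⟨x.1.1, mem_ker_invToCoinv.1 x.2, ?_⟩, Subtype.ext x.1.2⟩
        invFun := fun x ↦ ⟨⟨x.1.1, congrArg Subtype.val x.2⟩, mem_ker_invToCoinv.2 x.1.2.1⟩
        left_inv := fun _ ↦ rfl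
        right_inv := fun _ ↦ rfl }
    obtain ⟨⟨x, hx⟩, hx'⟩ := x
    obtain ⟨y, rfl⟩ := mem_ker_invToCoinv.1 hx'
    exact mem_torsion_of_apply_apply_eq_zero hc.ne_zero hQ h hx
  -- Both cokernels are quotients of `N = θ⁻¹(T)` by the same submodule.
  let N : Submodule R M := T.comap θ
  let α : N →ₗ[R] T ⧸ LinearMap.range θT :=
    (LinearMap.range θT).mkQ ∘ₗ θ.restrict (p := N) (q := T) fun _ hx ↦ hx
  let β : N →ₗ[R] (M ⧸ LinearMap.range θ) ⧸ LinearMap.range (invToCoinv θ) :=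
    (LinearMap.range (invToCoinv θ)).mkQ ∘ₗ (LinearMap.range θ).mkQ ∘ₗ N.subtype
  have hα : Function.Surjective α := by
    intro t
    obtain ⟨⟨_, ⟨x, rfl⟩, ht⟩, rfl⟩ := Submodule.mkQ_surjective _ t
    exact ⟨⟨x, ⟨x, rfl⟩, ht⟩, rfl⟩
  have hβ : Function.Surjective β := by
    intro x
    obtain ⟨x, rfl⟩ := Submodule.mkQ_surjective _ x
    obtain ⟨x, rfl⟩ := Submodule.mkQ_surjective _ x
    obtain ⟨u, rfl⟩ := hc
    let v : R := (u⁻¹ : Rˣ)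
    have hv : v * u = 1 := u.inv_mul
    refine ⟨v • ⟨(u : R) • x + θ (Q x), ⟨_, rfl⟩, h x⟩, ?_⟩
    change (LinearMap.range (invToCoinv θ)).mkQ ((LinearMap.range θ).mkQ
      (v • ((u : R) • x + θ (Q x)))) = _
    congr 1
    rw [Submodule.mkQ_apply, Submodule.mkQ_apply, Submodule.Quotient.eq]
    refine ⟨v • Q x, ?_⟩
    rw [smul_add, smul_smul, hv, one_smul, map_smul]
    abel
  have hαβ : LinearMap.ker α = LinearMap.ker β := by
    ext ⟨x, hx⟩
    have hl : (⟨x, hx⟩ : N) ∈ LinearMap.ker α ↔ ∃ t ∈ T, θ t = θ x := by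
      rw [LinearMap.mem_ker]
      change (LinearMap.range θT).mkQ ⟨θ x, hx⟩ = 0 ↔ _
      rw [Submodule.mkQ_apply, Submodule.Quotient.mk_eq_zero]
      exact ⟨fun ⟨t, ht⟩ ↦ ⟨t, t.2, congrArg Subtype.val ht⟩,
        fun ⟨t, ht, htx⟩ ↦ ⟨⟨t, ht⟩, Subtype.ext htx⟩⟩
    have hr : (⟨x, hx⟩ : N) ∈ LinearMap.ker β ↔ ∃ k ∈ LinearMap.ker θ, ∃ y, x = k + θ y := by
      rw [LinearMap.mem_ker]
      change (LinearMap.range (invToCoinv θ)).mkQ ((LinearMap.range θ).mkQ x) = 0 ↔ _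
      rw [← mk_mem_range_invToCoinv, Submodule.mkQ_apply, Submodule.Quotient.mk_eq_zero]
    rw [hl, hr]
    constructor
    · rintro ⟨_, ⟨⟨y, rfl⟩, -⟩, hy⟩
      exact ⟨x - θ y, by rw [LinearMap.mem_ker, map_sub, hy, sub_self], y, by abel⟩
    · rintro ⟨k, hk, y, rfl⟩
      rw [LinearMap.mem_ker] at hk
      have hθ : θ (k + θ y) = θ (θ y) := by rw [map_add, hk, zero_add]
      refine ⟨θ y, ⟨⟨y, rfl⟩, ?_⟩, hθ.symm⟩
      have htors : θ (k + θ y) ∈ Submodule.torsion R M := hx.2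
      rw [hθ] at htors
      obtain ⟨a, ha⟩ := (Submodule.mem_torsion_iff _).1 htors
      have ha' : θ (θ ((a : R) • y)) = 0 := by
        rw [map_smul, map_smul]
        exact ha
      have := mem_torsion_of_apply_apply_eq_zero hc.ne_zero hQ h ha'
      rw [map_smul] at this
      exact mem_torsion_of_smul_mem_torsion (nonZeroDivisors.ne_zero a.2) this
  rw [hker, card_ker_eq_card_quotient_range θT,
    ← Nat.card_congr (α.quotKerEquivOfSurjective hα).toEquiv, hαβ,
    Nat.card_congr (β.quotKerEquivOfSurjective hβ).toEquiv]

end InvToCoinv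

/-- Taylor expansion at `1` to first order, evaluated at an endomorphism. -/
theorem exists_commute_aeval_eq {R : Type} [CommRing R] {M : Type} [AddCommGroup M] [Module R M]
    (F : Module.End R M) (P : Polynomial ℤ) :
    ∃ Q : Module.End R M, Commute (F - 1) Q ∧
      ∀ x, Polynomial.aeval F P x = ((P.eval 1 : ℤ) : R) • x + (F - 1) (Q x) := by
  have hsub : Polynomial.aeval F (Polynomial.X - Polynomial.C (1 : ℤ)) = F - 1 := by simp
  refine ⟨Polynomial.aeval F (P /ₘ (Polynomial.X - Polynomial.C 1)), ?_, fun x ↦ ?_⟩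
  · rw [← hsub]
    exact (Commute.all _ _).map (Polynomial.aeval F)
  · conv_lhs => rw [← Polynomial.modByMonic_add_div P (Polynomial.X - Polynomial.C 1)]
    rw [Polynomial.modByMonic_X_sub_C_eq_C_eval, map_add, map_mul, hsub, Polynomial.aeval_C,
      LinearMap.add_apply, Module.End.mul_apply, Module.algebraMap_end_apply, Int.cast_smul_eq_zsmul]

theorem stmt_0 (p : ℕ) (hp : p.Prime)
    (M : (ℓ : ℕ) → [Fact ℓ.Prime] → Type)
    [instAdd : ∀ (ℓ : ℕ) [Fact ℓ.Prime], AddCommGroup (M ℓ)]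
    [instMod : ∀ (ℓ : ℕ) [Fact ℓ.Prime], Module ℤ_[ℓ] (M ℓ)]
    [instFin : ∀ (ℓ : ℕ) [Fact ℓ.Prime], Module.Finite ℤ_[ℓ] (M ℓ)]
    (F : (ℓ : ℕ) → [Fact ℓ.Prime] → Module.End ℤ_[ℓ] (M ℓ))
    (hF : ∀ (ℓ : ℕ) [Fact ℓ.Prime], ℓ ≠ p → Function.Bijective (F ℓ))
    (P : Polynomial ℤ) (hP : P.eval 1 ≠ 0)
    (hcomp : ∀ (ℓ : ℕ) [Fact ℓ.Prime], ℓ ≠ p → ∀ x : M ℓ,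
      ∃ n : ℕ, (ℓ : ℤ_[ℓ]) ^ n •
        ((F ℓ - 1) ((Polynomial.aeval (F ℓ)) P x)) = 0) :
    (∀ (ℓ : ℕ) [Fact ℓ.Prime], ℓ ≠ p →
      Finite (LinearMap.ker (invToCoinv (F ℓ - 1))) ∧
      Finite ((M ℓ ⧸ LinearMap.range (F ℓ - 1)) ⧸
        LinearMap.range (invToCoinv (F ℓ - 1)))) ∧
    (∀ᶠ ℓ in Filter.cofinite, ∀ [Fact ℓ.Prime], ℓ ≠ p →
      Nat.card (LinearMap.ker (invToCoinv (F ℓ - 1))) =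
      Nat.card ((M ℓ ⧸ LinearMap.range (F ℓ - 1)) ⧸
        LinearMap.range (invToCoinv (F ℓ - 1)))) := by
  have key : ∀ (ℓ : ℕ) [Fact ℓ.Prime], ℓ ≠ p → ∃ Q : Module.End ℤ_[ℓ] (M ℓ),
      Commute (F ℓ - 1) Q ∧ ∀ x, (F ℓ - 1) (((P.eval 1 : ℤ) : ℤ_[ℓ]) • x + (F ℓ - 1) (Q x)) ∈
        Submodule.torsion ℤ_[ℓ] (M ℓ) := by
    intro ℓ hℓ hne
    obtain ⟨Q, hQ, hPQ⟩ := exists_commute_aeval_eq (F ℓ) P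
    refine ⟨Q, hQ, fun x ↦ ?_⟩
    obtain ⟨n, hn⟩ := hcomp ℓ hne x
    rw [← hPQ, Submodule.mem_torsion_iff]
    have hℓ0 : (ℓ : ℤ_[ℓ]) ≠ 0 := Nat.cast_ne_zero.2 hℓ.out.ne_zero
    exact ⟨⟨(ℓ : ℤ_[ℓ]) ^ n, mem_nonZeroDivisors_of_ne_zero (pow_ne_zero n hℓ0)⟩, hn⟩
  constructor
  · intro ℓ _ hne
    have := padicInt_hasFiniteQuotients ℓ
    obtain ⟨Q, hQ, h⟩ := key ℓ hne
    have hc : ((P.eval 1 : ℤ) : ℤ_[ℓ]) ≠ 0 := Int.cast_ne_zero.2 hP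
    exact ⟨finite_ker_invToCoinv hc hQ h, finite_coker_invToCoinv hc h⟩
  · have hfin : {ℓ : ℕ | (ℓ : ℤ) ∣ P.eval 1}.Finite := by
      refine (Nat.divisors (P.eval 1).natAbs).finite_toSet.subset fun ℓ hℓ ↦ ?_
      exact Nat.mem_divisors.2 ⟨Int.natCast_dvd.1 hℓ, Int.natAbs_ne_zero.2 hP⟩
    filter_upwards [hfin.compl_mem_cofinite] with ℓ hℓ _ hne
    have := padicInt_hasFiniteQuotients ℓ
    obtain ⟨Q, hQ, h⟩ := key ℓ hne
    have hc : IsUnit ((P.eval 1 : ℤ) : ℤ_[ℓ]) := by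
      by_contra hc
      exact hℓ ((PadicInt.norm_int_lt_one_iff_dvd _).1 (PadicInt.not_isUnit_iff.1 hc))
    exact card_ker_invToCoinv_eq_card_coker hc hQ h
end

section
/- Let p be a prime. For every prime ℓ ≠ p, let M_ℓ be a finitely generated module over the ring ℤ_ℓ of ℓ-adic integers and let F_ℓ : M_ℓ → M_ℓ be a ℤ_ℓ-linear automorphism, forming a compatible system (there exists P ∈ ℤ[T] with P(1) ≠ 0 such that for every ℓ and every x ∈ M_ℓ, ((F_ℓ − 1) ∘ P(F_ℓ))(x) is annihilated by a power of ℓ). Assume moreover that for every ℓ ≠ p the kernel of F_ℓ − 1 on M_ℓ is a torsion ℤ_ℓ-module (equivalently, 1 is not an eigenvalue of F_ℓ acting on M_ℓ ⊗ ℚ_ℓ). Then for all but finitely many primes ℓ, both ker(F_ℓ − 1) and M_ℓ/(F_ℓ − 1)M_ℓ are finite and they have the same cardinality. -/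
open Polynomial

/-- If a finite submodule `T` is equal to its own preimage under the endomorphism `G`, and `G` is
surjective modulo `T`, then `G` has finite kernel and cokernel, of the same cardinality. -/
theorem LinearMap.card_ker_eq_card_coker_of_finite_submodule {R M : Type*} [Ring R]
    [AddCommGroup M] [Module R M] (G : Module.End R M) (T : Submodule R M) [Finite T]
    (hT : ∀ x, G x ∈ T ↔ x ∈ T) (hsup : T ⊔ LinearMap.range G = ⊤) :
    Finite (LinearMap.ker G) ∧ Finite (M ⧸ LinearMap.range G) ∧
      Nat.card (LinearMap.ker G) = Nat.card (M ⧸ LinearMap.range G) := by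
  have hker : LinearMap.ker G ≤ T := fun x hx => (hT x).1 (by rw [hx]; exact T.zero_mem)
  let g : T →ₗ[R] T := G.restrict fun x hx => (hT x).2 hx
  let q : T →ₗ[R] M ⧸ LinearMap.range G := (LinearMap.range G).mkQ ∘ₗ T.subtype
  have hq : Function.Surjective q := by
    intro y
    obtain ⟨x, rfl⟩ := (LinearMap.range G).mkQ_surjective y
    obtain ⟨t, ht, z, hz, rfl⟩ := Submodule.mem_sup.1 (hsup ▸ Submodule.mem_top (x := x))
    refine ⟨⟨t, ht⟩, ?_⟩
    simpa [q] using hz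
  have hqker : LinearMap.ker q = LinearMap.range g := by
    ext t
    simp only [q, LinearMap.mem_ker, LinearMap.comp_apply, Submodule.subtype_apply,
      Submodule.mkQ_apply, Submodule.Quotient.mk_eq_zero, LinearMap.mem_range]
    constructor
    · rintro ⟨x, hx⟩
      exact ⟨⟨x, (hT x).1 (hx ▸ t.2)⟩, Subtype.ext hx⟩
    · rintro ⟨x, rfl⟩
      exact ⟨x, rfl⟩
  have hgker : Nat.card (LinearMap.ker g) = Nat.card (LinearMap.ker G) :=
    Nat.card_congr
      { toFun := fun t => ⟨t.1.1, congrArg Subtype.val t.2⟩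
        invFun := fun x => ⟨⟨x.1, hker x.2⟩, Subtype.ext x.2⟩
        left_inv := fun _ => rfl
        right_inv := fun _ => rfl }
  refine ⟨Finite.of_injective _ (Submodule.inclusion_injective hker), Finite.of_surjective q hq, ?_⟩
  have h₁ := (LinearMap.ker g).card_eq_card_quotient_mul_card
  have h₂ := (LinearMap.range g).card_eq_card_quotient_mul_card
  rw [Nat.card_congr g.quotKerEquivRange.toEquiv, hgker] at h₁
  rw [← hqker, Nat.card_congr (q.quotKerEquivOfSurjective hq).toEquiv, hqker, h₁, mul_comm] at h₂
  exact Nat.eq_of_mul_eq_mul_left Nat.card_pos h₂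

theorem PadicInt.finite_quotient_span {ℓ : ℕ} [Fact ℓ.Prime] {c : ℤ_[ℓ]} (hc : c ≠ 0) :
    Finite (ℤ_[ℓ] ⧸ Ideal.span {c}) := by
  rw [(Ideal.span_singleton_eq_span_singleton (y := (ℓ : ℤ_[ℓ]) ^ c.valuation)).2
    ⟨(PadicInt.unitCoeff hc)⁻¹, ?_⟩, ← PadicInt.ker_toZModPow]
  · have : NeZero (ℓ ^ c.valuation) := ⟨pow_ne_zero _ (Fact.out : ℓ.Prime).ne_zero⟩
    exact Finite.of_injective _
      (RingHom.kerLift_injective (PadicInt.toZModPow (p := ℓ) c.valuation))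
  · rw [Units.mul_inv_eq_iff_eq_mul, mul_comm]
    exact PadicInt.unitCoeff_spec hc

theorem PadicInt.finite_of_isTorsion {ℓ : ℕ} [Fact ℓ.Prime] {T : Type*} [AddCommGroup T]
    [Module ℤ_[ℓ] T] [Module.Finite ℤ_[ℓ] T] (hT : Module.IsTorsion ℤ_[ℓ] T) : Finite T := by
  obtain ⟨c, hc, hc0⟩ := Submodule.annihilator_top_inter_nonZeroDivisors hT
  have := PadicInt.finite_quotient_span (nonZeroDivisors.ne_zero hc0)
  have hbot : Ideal.span {c} • (⊤ : Submodule ℤ_[ℓ] T) = ⊥ := by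
    rw [Submodule.ideal_span_singleton_smul, eq_bot_iff]
    rintro _ ⟨x, hx, rfl⟩
    exact Submodule.mem_annihilator.1 hc x hx
  have : Finite (T ⧸ (⊤ : Submodule ℤ_[ℓ] T)) := inferInstance
  have := Submodule.finite_quotient_smul (Ideal.span {c}) (N := (⊤ : Submodule ℤ_[ℓ] T))
    Module.Finite.fg_top
  rw [hbot] at this
  exact Finite.of_equiv _ (Submodule.quotEquivOfEqBot (⊥ : Submodule ℤ_[ℓ] T) rfl).toEquiv

theorem Module.End.card_ker_sub_one_eq_card_coker {ℓ : ℕ} [Fact ℓ.Prime] {M : Type*}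
    [AddCommGroup M] [Module ℤ_[ℓ] M] [Module.Finite ℤ_[ℓ] M] (F : Module.End ℤ_[ℓ] M)
    (P : ℤ[X]) (hP : ¬ (ℓ : ℤ) ∣ P.eval 1)
    (hcomp : ∀ x : M, (F - 1) (aeval F P x) ∈ Submodule.torsion ℤ_[ℓ] M)
    (hker : LinearMap.ker (F - 1) ≤ Submodule.torsion ℤ_[ℓ] M) :
    Finite (LinearMap.ker (F - 1)) ∧ Finite (M ⧸ LinearMap.range (F - 1)) ∧
      Nat.card (LinearMap.ker (F - 1)) = Nat.card (M ⧸ LinearMap.range (F - 1)) := by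
  have : Finite (Submodule.torsion ℤ_[ℓ] M) :=
    PadicInt.finite_of_isTorsion Submodule.torsion_isTorsion
  have hT (x : M) : (F - 1) x ∈ Submodule.torsion ℤ_[ℓ] M ↔ x ∈ Submodule.torsion ℤ_[ℓ] M := by
    simp only [Submodule.mem_torsion_iff]
    refine ⟨fun ⟨a, ha⟩ => ?_, fun ⟨a, ha⟩ => ⟨a, ?_⟩⟩
    · obtain ⟨b, hb⟩ := (Submodule.mem_torsion_iff _).1
        (hker (show a • x ∈ LinearMap.ker (F - 1) by
          rw [LinearMap.mem_ker, Submonoid.smul_def, map_smul]; exact ha))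
      exact ⟨b * a, by rw [mul_smul, hb]⟩
    · rw [Submonoid.smul_def] at ha ⊢
      rw [← map_smul, ha, map_zero]
  refine LinearMap.card_ker_eq_card_coker_of_finite_submodule _ _ hT ?_
  rw [eq_top_iff]
  rintro x -
  obtain ⟨u, hu⟩ : IsUnit ((P.eval 1 : ℤ) : ℤ_[ℓ]) := by
    by_contra h
    exact hP ((PadicInt.norm_int_lt_one_iff_dvd _).1 (PadicInt.not_isUnit_iff.1 h))
  obtain ⟨Q, hQ⟩ := X_sub_C_dvd_sub_C_eval (a := (1 : ℤ)) (p := P)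
  have hPx : aeval F P x = (F - 1) (aeval F Q x) + (u : ℤ_[ℓ]) • x := by
    rw [sub_eq_iff_eq_add.1 hQ, hu]
    simp [Int.cast_smul_eq_zsmul]
  have hx : x = (↑u⁻¹ : ℤ_[ℓ]) • aeval F P x + (F - 1) (-((↑u⁻¹ : ℤ_[ℓ]) • aeval F Q x)) := by
    rw [hPx, map_neg, map_smul, smul_add, smul_smul, Units.inv_mul, one_smul]
    abel
  rw [hx]
  exact Submodule.add_mem_sup (Submodule.smul_mem _ _ ((hT _).1 (hcomp x)))
    (LinearMap.mem_range_self _ _)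

theorem stmt_1 (p : ℕ) (hp : p.Prime)
    (M : (ℓ : ℕ) → [Fact ℓ.Prime] → Type)
    [instAdd : ∀ (ℓ : ℕ) [Fact ℓ.Prime], AddCommGroup (M ℓ)]
    [instMod : ∀ (ℓ : ℕ) [Fact ℓ.Prime], Module ℤ_[ℓ] (M ℓ)]
    [instFin : ∀ (ℓ : ℕ) [Fact ℓ.Prime], Module.Finite ℤ_[ℓ] (M ℓ)]
    (F : (ℓ : ℕ) → [Fact ℓ.Prime] → Module.End ℤ_[ℓ] (M ℓ))
    (hF : ∀ (ℓ : ℕ) [Fact ℓ.Prime], ℓ ≠ p → Function.Bijective (F ℓ))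
    (P : Polynomial ℤ) (hP : P.eval 1 ≠ 0)
    (hcomp : ∀ (ℓ : ℕ) [Fact ℓ.Prime], ℓ ≠ p → ∀ x : M ℓ,
      ∃ n : ℕ, (ℓ : ℤ_[ℓ]) ^ n •
        ((F ℓ - 1) ((Polynomial.aeval (F ℓ)) P x)) = 0)
    (htor : ∀ (ℓ : ℕ) [Fact ℓ.Prime], ℓ ≠ p →
      ∀ x : LinearMap.ker (F ℓ - 1), ∃ c : ℤ_[ℓ], c ≠ 0 ∧ c • x = 0) :
    ∀ᶠ ℓ in Filter.cofinite, ∀ [Fact ℓ.Prime], ℓ ≠ p →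
      Finite (LinearMap.ker (F ℓ - 1)) ∧
      Finite (M ℓ ⧸ LinearMap.range (F ℓ - 1)) ∧
      Nat.card (LinearMap.ker (F ℓ - 1)) =
        Nat.card (M ℓ ⧸ LinearMap.range (F ℓ - 1)) := by
  have hfin : {ℓ : ℕ | (ℓ : ℤ) ∣ P.eval 1}.Finite :=
    (Nat.divisors (P.eval 1).natAbs).finite_toSet.subset fun ℓ hℓ => by
      simpa [hP] using Int.natAbs_dvd_natAbs.2 hℓ
  filter_upwards [hfin.compl_mem_cofinite] with ℓ hℓ _ hne
  refine Module.End.card_ker_sub_one_eq_card_coker (F ℓ) P hℓ (fun x => ?_) fun x hx => ?_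
  · obtain ⟨n, hn⟩ := hcomp ℓ hne x
    have hℓ0 : (ℓ : ℤ_[ℓ]) ≠ 0 := Nat.cast_ne_zero.2 (Fact.out : ℓ.Prime).ne_zero
    exact (Submodule.mem_torsion_iff _).2
      ⟨⟨_, mem_nonZeroDivisors_of_ne_zero (pow_ne_zero n hℓ0)⟩, hn⟩
  · obtain ⟨c, hc, hcx⟩ := htor ℓ hne ⟨x, hx⟩
    exact (Submodule.mem_torsion_iff _).2
      ⟨⟨c, mem_nonZeroDivisors_of_ne_zero hc⟩, congrArg Subtype.val hcx⟩
end

section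
/- Let p be a prime. For every prime ℓ ≠ p, let M_ℓ be a finitely generated module over the ring ℤ_ℓ of ℓ-adic integers and let F_ℓ : M_ℓ → M_ℓ be a ℤ_ℓ-linear automorphism, forming a compatible system (there exists P ∈ ℤ[T] with P(1) ≠ 0 such that for every ℓ and every x ∈ M_ℓ, ((F_ℓ − 1) ∘ P(F_ℓ))(x) is annihilated by a power of ℓ). Then for all but finitely many primes ℓ the following equivalence holds: ker(F_ℓ − 1) = 0 if and only if (F_ℓ − 1)M_ℓ = M_ℓ (i.e. the invariants vanish if and only if the coinvariants M_ℓ/(F_ℓ − 1)M_ℓ vanish). -/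
theorem PadicInt.finite_quotient_span_pow (ℓ : ℕ) [Fact ℓ.Prime] (n : ℕ) :
    Finite (ℤ_[ℓ] ⧸ Ideal.span {(ℓ : ℤ_[ℓ]) ^ n}) := by
  have : NeZero (ℓ ^ n) := ⟨pow_ne_zero _ (Fact.out : ℓ.Prime).ne_zero⟩
  rw [← PadicInt.ker_toZModPow]
  exact Finite.of_injective _ (RingHom.kerLift_injective (PadicInt.toZModPow (p := ℓ) n))

theorem PadicInt.finite_torsionBy_pow (ℓ : ℕ) [Fact ℓ.Prime] (M : Type*) [AddCommGroup M]
    [Module ℤ_[ℓ] M] [Module.Finite ℤ_[ℓ] M] (n : ℕ) :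
    Finite (Submodule.torsionBy ℤ_[ℓ] M ((ℓ : ℤ_[ℓ]) ^ n)) := by
  have := PadicInt.finite_quotient_span_pow ℓ n
  have : Module.Finite (ℤ_[ℓ] ⧸ Ideal.span {(ℓ : ℤ_[ℓ]) ^ n})
      (Submodule.torsionBy ℤ_[ℓ] M ((ℓ : ℤ_[ℓ]) ^ n)) :=
    Module.Finite.of_restrictScalars_finite ℤ_[ℓ] _ _
  exact Module.finite_of_finite (ℤ_[ℓ] ⧸ Ideal.span {(ℓ : ℤ_[ℓ]) ^ n})

/-- An injective endomorphism of a finitely generated `ℤ_ℓ`-module hits every element killed by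
a power of `ℓ`. -/
theorem PadicInt.mem_range_of_pow_smul_eq_zero {ℓ : ℕ} [Fact ℓ.Prime] {M : Type*}
    [AddCommGroup M] [Module ℤ_[ℓ] M] [Module.Finite ℤ_[ℓ] M] {A : Module.End ℤ_[ℓ] M}
    (hA : Function.Injective A) {n : ℕ} {x : M} (hx : (ℓ : ℤ_[ℓ]) ^ n • x = 0) :
    x ∈ LinearMap.range A := by
  have := PadicInt.finite_torsionBy_pow ℓ M n
  have hmaps : ∀ y ∈ Submodule.torsionBy ℤ_[ℓ] M ((ℓ : ℤ_[ℓ]) ^ n),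
      A y ∈ Submodule.torsionBy ℤ_[ℓ] M ((ℓ : ℤ_[ℓ]) ^ n) := by
    intro y hy
    rw [Submodule.mem_torsionBy_iff] at hy ⊢
    rw [← map_smul, hy, map_zero]
  have hinj : Function.Injective (A.restrict hmaps) := fun a b hab =>
    Subtype.ext (hA (congrArg Subtype.val hab))
  obtain ⟨y, hy⟩ := Finite.surjective_of_injective hinj
    ⟨x, (Submodule.mem_torsionBy_iff _ _).2 hx⟩
  exact ⟨y, congrArg Subtype.val hy⟩

/-- If `(F - 1) P(F)` vanishes up to `ℓ`-power torsion and `ℓ` does not divide `P(1)`, then `F - 1`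
is surjective as soon as it is injective. -/
theorem PadicInt.surjective_sub_one_of_injective {ℓ : ℕ} [Fact ℓ.Prime] {M : Type*}
    [AddCommGroup M] [Module ℤ_[ℓ] M] [Module.Finite ℤ_[ℓ] M] {F : Module.End ℤ_[ℓ] M}
    {P : Polynomial ℤ} (hP : ¬ (ℓ : ℤ) ∣ P.eval 1)
    (hcomp : ∀ x : M, ∃ n : ℕ, (ℓ : ℤ_[ℓ]) ^ n • ((F - 1) ((Polynomial.aeval F) P x)) = 0)
    (hinj : Function.Injective ⇑(F - 1)) : Function.Surjective ⇑(F - 1) := by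
  have hunit : IsUnit ((P.eval 1 : ℤ) : ℤ_[ℓ]) := by
    rw [PadicInt.isUnit_iff]
    refine le_antisymm (PadicInt.norm_le_one _) (not_lt.1 fun h => hP ?_)
    exact PadicInt.norm_int_lt_one_iff_dvd _ |>.1 h
  obtain ⟨u, hu⟩ := hunit
  obtain ⟨Q, hQ⟩ := Polynomial.X_sub_C_dvd_sub_C_eval (p := P) (a := 1)
  have hdecomp (x : M) : Polynomial.aeval F P x =
      (F - 1) (Polynomial.aeval F Q x) + (u : ℤ_[ℓ]) • x := by
    have h := congrArg (fun R => Polynomial.aeval F R x) (sub_eq_iff_eq_add.1 hQ)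
    simpa [hu, Int.cast_smul_eq_zsmul] using h
  rw [← LinearMap.range_eq_top, eq_top_iff]
  rintro x -
  obtain ⟨n, hn⟩ := hcomp x
  rw [← map_smul, map_eq_zero_iff _ hinj] at hn
  have hmem := PadicInt.mem_range_of_pow_smul_eq_zero hinj hn
  rw [hdecomp, Submodule.add_mem_iff_right _ (LinearMap.mem_range_self _ _)] at hmem
  exact (Submodule.smul_mem_iff_of_isUnit _ u.isUnit).1 hmem


theorem stmt_2 (p : ℕ) (hp : p.Prime)
    (M : (ℓ : ℕ) → [Fact ℓ.Prime] → Type)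
    [instAdd : ∀ (ℓ : ℕ) [Fact ℓ.Prime], AddCommGroup (M ℓ)]
    [instMod : ∀ (ℓ : ℕ) [Fact ℓ.Prime], Module ℤ_[ℓ] (M ℓ)]
    [instFin : ∀ (ℓ : ℕ) [Fact ℓ.Prime], Module.Finite ℤ_[ℓ] (M ℓ)]
    (F : (ℓ : ℕ) → [Fact ℓ.Prime] → Module.End ℤ_[ℓ] (M ℓ))
    (hF : ∀ (ℓ : ℕ) [Fact ℓ.Prime], ℓ ≠ p → Function.Bijective (F ℓ))
    (P : Polynomial ℤ) (hP : P.eval 1 ≠ 0)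
    (hcomp : ∀ (ℓ : ℕ) [Fact ℓ.Prime], ℓ ≠ p → ∀ x : M ℓ,
      ∃ n : ℕ, (ℓ : ℤ_[ℓ]) ^ n •
        ((F ℓ - 1) ((Polynomial.aeval (F ℓ)) P x)) = 0) :
    ∀ᶠ ℓ in Filter.cofinite, ∀ [Fact ℓ.Prime], ℓ ≠ p →
      (LinearMap.ker (F ℓ - 1) = ⊥ ↔ LinearMap.range (F ℓ - 1) = ⊤) := by
  have hfin : {ℓ : ℕ | (ℓ : ℤ) ∣ P.eval 1}.Finite :=
    (Set.finite_Iic (P.eval 1).natAbs).subset fun ℓ hℓ =>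
      Nat.le_of_dvd (Int.natAbs_pos.2 hP) (Int.natCast_dvd.1 hℓ)
  filter_upwards [hfin.compl_mem_cofinite] with ℓ hℓ _ hne
  rw [LinearMap.ker_eq_bot, LinearMap.range_eq_top]
  exact ⟨PadicInt.surjective_sub_one_of_injective hℓ (hcomp ℓ hne),
    OrzechProperty.injective_of_surjective_endomorphism _⟩
end

section
/- Let p be a prime. For every prime ℓ ≠ p, let M_ℓ be a finitely generated torsion-free module over the ring ℤ_ℓ of ℓ-adic integers and let F_ℓ : M_ℓ → M_ℓ be a ℤ_ℓ-linear automorphism, forming a compatible system (there exists P ∈ ℤ[T] with P(1) ≠ 0 such that for every ℓ and every x ∈ M_ℓ, ((F_ℓ − 1) ∘ P(F_ℓ))(x) is annihilated by a power of ℓ). Let f_ℓ : ker(F_ℓ − 1) → M_ℓ/(F_ℓ − 1)M_ℓ be the map induced by the identity of M_ℓ. Then for all but finitely many primes ℓ, the map f_ℓ is bijective; in particular, for all but finitely many primes ℓ, the coinvariants M_ℓ/(F_ℓ − 1)M_ℓ have no nonzero element killed by ℓ. -/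
/-- If `θ` is annihilated by an endomorphism `Q` commuting with it which is congruent to a unit
scalar modulo `θ`, then invariants map isomorphically to coinvariants. -/
lemma bijective_invToCoinv {R : Type} [CommRing R] {M : Type} [AddCommGroup M] [Module R M]
    {θ Q S : Module.End R M} {c : R} (hc : IsUnit c) (hθQ : θ * Q = 0) (hQθ : Q * θ = 0)
    (hθS : Commute θ S) (hQ : Q = θ * S + algebraMap R (Module.End R M) c) :
    Function.Bijective (invToCoinv θ) := by
  have hQx (x : M) : Q x = θ (S x) + c • x := by
    rw [hQ]
    simp [Module.algebraMap_end_apply]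
  constructor
  · refine (injective_iff_map_eq_zero _).mpr ?_
    rintro ⟨x, hx⟩ h
    obtain ⟨y, rfl⟩ : x ∈ LinearMap.range θ := by simpa [invToCoinv] using h
    have hSx : θ (S (θ y)) = 0 := by
      rw [← Module.End.mul_apply, hθS.eq, Module.End.mul_apply, LinearMap.mem_ker.mp hx, map_zero]
    have hcx : c • θ y = 0 := by
      have h0 : Q (θ y) = 0 := LinearMap.congr_fun hQθ y
      rwa [hQx, hSx, zero_add] at h0
    exact Subtype.ext (hc.smul_eq_zero.mp hcx)
  · intro z
    obtain ⟨x, rfl⟩ := Submodule.mkQ_surjective _ z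
    obtain ⟨u, rfl⟩ := hc
    have hker : (↑u⁻¹ : R) • Q x ∈ LinearMap.ker θ := by
      have h0 : θ (Q x) = 0 := LinearMap.congr_fun hθQ x
      simp [h0]
    refine ⟨⟨_, hker⟩, ?_⟩
    refine (Submodule.Quotient.eq _).mpr ⟨(↑u⁻¹ : R) • S x, ?_⟩
    simp [hQx, smul_add, smul_smul]

theorem stmt_3 (p : ℕ) (hp : p.Prime)
    (M : (ℓ : ℕ) → [Fact ℓ.Prime] → Type)
    [instAdd : ∀ (ℓ : ℕ) [Fact ℓ.Prime], AddCommGroup (M ℓ)]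
    [instMod : ∀ (ℓ : ℕ) [Fact ℓ.Prime], Module ℤ_[ℓ] (M ℓ)]
    [instFin : ∀ (ℓ : ℕ) [Fact ℓ.Prime], Module.Finite ℤ_[ℓ] (M ℓ)]
    -- each `M ℓ` is torsion-free over `ℤ_ℓ`
    (htf : ∀ (ℓ : ℕ) [Fact ℓ.Prime], ∀ (c : ℤ_[ℓ]) (x : M ℓ), c • x = 0 → c = 0 ∨ x = 0)
    (F : (ℓ : ℕ) → [Fact ℓ.Prime] → Module.End ℤ_[ℓ] (M ℓ))
    (hF : ∀ (ℓ : ℕ) [Fact ℓ.Prime], ℓ ≠ p → Function.Bijective (F ℓ))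
    (P : Polynomial ℤ) (hP : P.eval 1 ≠ 0)
    (hcomp : ∀ (ℓ : ℕ) [Fact ℓ.Prime], ℓ ≠ p → ∀ x : M ℓ,
      ∃ n : ℕ, (ℓ : ℤ_[ℓ]) ^ n •
        ((F ℓ - 1) ((Polynomial.aeval (F ℓ)) P x)) = 0) :
    ∀ᶠ ℓ in Filter.cofinite, ∀ [Fact ℓ.Prime], ℓ ≠ p →
      Function.Bijective (invToCoinv (F ℓ - 1)) ∧
      ∀ x : M ℓ ⧸ LinearMap.range (F ℓ - 1), ℓ • x = 0 → x = 0 := by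
  have hfin : {ℓ : ℕ | (ℓ : ℤ) ∣ P.eval 1}.Finite := by
    refine (Set.finite_Iic (P.eval 1).natAbs).subset fun ℓ hℓ ↦ ?_
    exact Nat.le_of_dvd (Int.natAbs_pos.mpr hP) (Int.natCast_dvd.mp hℓ)
  filter_upwards [hfin.compl_mem_cofinite] with ℓ hℓ _ hℓp
  have hℓ0 : (ℓ : ℤ_[ℓ]) ≠ 0 := Nat.cast_ne_zero.mpr (Fact.out : ℓ.Prime).ne_zero
  have hunit : IsUnit ((P.eval 1 : ℤ) : ℤ_[ℓ]) := by
    rw [PadicInt.isUnit_iff]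
    refine le_antisymm (PadicInt.norm_le_one _) (not_lt.mp fun h ↦ hℓ ?_)
    exact (PadicInt.norm_int_lt_one_iff_dvd _).mp h
  have hθQ : (F ℓ - 1) * Polynomial.aeval (F ℓ) P = 0 := by
    ext x
    obtain ⟨n, hn⟩ := hcomp ℓ hℓp x
    exact (htf ℓ _ _ hn).resolve_left (pow_ne_zero n hℓ0)
  have hθ : F ℓ - 1 = Polynomial.aeval (F ℓ) (Polynomial.X - 1 : Polynomial ℤ) := by simp
  have hcomm (A : Polynomial ℤ) : Commute (F ℓ - 1) (Polynomial.aeval (F ℓ) A) := by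
    rw [hθ]
    exact (Commute.all _ A).map (Polynomial.aeval (F ℓ))
  obtain ⟨A, hA⟩ : Polynomial.X - 1 ∣ P - Polynomial.C (P.eval 1) := by
    simpa using Polynomial.X_sub_C_dvd_sub_C_eval (a := 1) (p := P)
  have hQ : Polynomial.aeval (F ℓ) P = (F ℓ - 1) * Polynomial.aeval (F ℓ) A +
      algebraMap ℤ_[ℓ] (Module.End ℤ_[ℓ] (M ℓ)) ((P.eval 1 : ℤ) : ℤ_[ℓ]) := by
    have h := congrArg (Polynomial.aeval (F ℓ)) (sub_eq_iff_eq_add.mp hA)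
    simpa using h
  have hbij : Function.Bijective (invToCoinv (F ℓ - 1)) :=
    bijective_invToCoinv hunit hθQ ((hcomm P).eq ▸ hθQ) (hcomm A) hQ
  refine ⟨hbij, fun x hx ↦ ?_⟩
  obtain ⟨y, rfl⟩ := hbij.2 x
  have hy : ℓ • y = 0 := hbij.1 (by rw [map_nsmul, hx, map_zero])
  have hy' : (ℓ : ℤ_[ℓ]) • (y : M ℓ) = 0 := by
    rw [Nat.cast_smul_eq_nsmul]
    exact congrArg Subtype.val hy
  have hy0 : y = 0 := Subtype.ext ((htf ℓ _ _ hy').resolve_left hℓ0)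
  rw [hy0, map_zero]
end

section
/- Let P ∈ ℚ[T] be a nonzero polynomial. For each prime ℓ, let Q_ℓ ∈ ℚ_ℓ[T] be a monic polynomial with Q_ℓ(0) ≠ 0 such that Q_ℓ divides the image of P^{m_ℓ} in ℚ_ℓ[T] for some integer m_ℓ ≥ 1 (where ℚ is viewed inside the field ℚ_ℓ of ℓ-adic numbers). Then for all but finitely many primes ℓ, the ℓ-adic absolute value of Q_ℓ(0) equals 1. -/
open Polynomial in
/-- A monic factor over `ℚ_[p]` of a monic polynomial over `ℤ_[p]` has `p`-integral constant
term. -/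
theorem norm_eval_zero_le_one_of_dvd_map {p : ℕ} [Fact p.Prime] {f : ℤ_[p][X]} (hf : f.Monic)
    {g : ℚ_[p][X]} (hg : g.Monic) (h : g ∣ f.map (algebraMap ℤ_[p] ℚ_[p])) :
    ‖g.eval 0‖ ≤ 1 := by
  obtain ⟨g', hg'⟩ := IsIntegrallyClosed.eq_map_mul_C_of_dvd ℚ_[p] hf h
  rw [hg.leadingCoeff, C_1, mul_one] at hg'
  have : g.eval 0 = algebraMap ℤ_[p] ℚ_[p] (g'.eval 0) := by
    rw [← hg', ← coeff_zero_eq_eval_zero, coeff_map, coeff_zero_eq_eval_zero]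
  rw [this]
  exact PadicInt.norm_le_one _

/-- A rational number is `ℓ`-integral for all but finitely many primes `ℓ`. -/
theorem eventually_norm_padic_rat_le_one (q : ℚ) :
    ∀ᶠ ℓ in Filter.cofinite, ∀ [Fact (Nat.Prime ℓ)], ‖(q : ℚ_[ℓ])‖ ≤ 1 := by
  rw [Nat.cofinite_eq_atTop]
  filter_upwards [Filter.eventually_gt_atTop q.den] with ℓ hℓ _
  exact Padic.norm_rat_le_one fun h => hℓ.not_ge (Nat.le_of_dvd q.den_pos h)

open Polynomial in
/-- If `f` is monic over `ℚ_[p]` with `p`-integral coefficients and unit constant term, then every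
monic divisor of a power of `f` has unit constant term. -/
theorem norm_eval_zero_eq_one_of_dvd_pow {p : ℕ} [Fact p.Prime] {f g : ℚ_[p][X]} (hf : f.Monic)
    (hcoeff : ∀ i, ‖f.coeff i‖ ≤ 1) (hf0 : ‖f.eval 0‖ = 1) (hg : g.Monic) {m : ℕ}
    (h : g ∣ f ^ m) : ‖g.eval 0‖ = 1 := by
  have hlift : f ∈ lifts (algebraMap ℤ_[p] ℚ_[p]) := by
    rw [lifts_iff_coeff_lifts]
    exact fun i => ⟨⟨f.coeff i, hcoeff i⟩, rfl⟩
  obtain ⟨F, hF, -, hFmonic⟩ := lifts_and_natDegree_eq_and_monic hlift hf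
  obtain ⟨r, hr⟩ := h
  have hrmonic : r.Monic := hg.of_mul_monic_left (hr ▸ hf.pow m)
  have hmap : (F ^ m).map (algebraMap ℤ_[p] ℚ_[p]) = g * r := by
    rw [Polynomial.map_pow, hF, hr]
  have hg1 := norm_eval_zero_le_one_of_dvd_map (hFmonic.pow m) hg (hmap ▸ dvd_mul_right g r)
  have hr1 := norm_eval_zero_le_one_of_dvd_map (hFmonic.pow m) hrmonic (hmap ▸ dvd_mul_left r g)
  have hprod : ‖g.eval 0‖ * ‖r.eval 0‖ = 1 := by
    rw [← norm_mul, ← eval_mul, ← hr, eval_pow, norm_pow, hf0, one_pow]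
  refine le_antisymm hg1 ?_
  rw [← hprod]
  exact mul_le_of_le_one_right (norm_nonneg _) hr1

open Polynomial in
/-- A nonzero polynomial over a field is a nonzero constant times a power of `X` times a monic
polynomial with nonzero constant term. -/
theorem exists_eq_C_mul_X_pow_mul_monic {K : Type*} [Field K] {P : K[X]} (hP : P ≠ 0) :
    ∃ (c : K) (n : ℕ) (R : K[X]), c ≠ 0 ∧ R.Monic ∧ R.eval 0 ≠ 0 ∧ P = C c * X ^ n * R := by
  obtain ⟨q, hq, hnd⟩ := exists_eq_pow_rootMultiplicity_mul_and_not_dvd P hP 0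
  rw [dvd_iff_isRoot, IsRoot.def] at hnd
  have hq0 : q ≠ 0 := by
    rintro rfl
    simp at hnd
  have hlc : q.leadingCoeff ≠ 0 := leadingCoeff_ne_zero.mpr hq0
  refine ⟨q.leadingCoeff, P.rootMultiplicity 0, q * C q.leadingCoeff⁻¹, hlc,
    monic_mul_leadingCoeff_inv hq0, by simp [hnd, hq0], ?_⟩
  have hC : C q.leadingCoeff * C q.leadingCoeff⁻¹ = 1 := by
    rw [← C_mul, mul_inv_cancel₀ hlc, C_1]
  rw [C_0, sub_zero] at hq
  calc P = X ^ P.rootMultiplicity 0 * q * (C q.leadingCoeff * C q.leadingCoeff⁻¹) := by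
        rw [hC, mul_one]; exact hq
    _ = _ := by ring

theorem stmt_6 (P : Polynomial ℚ) (hP : P ≠ 0)
    (Q : (ℓ : ℕ) → [Fact ℓ.Prime] → Polynomial ℚ_[ℓ])
    (m : (ℓ : ℕ) → [Fact ℓ.Prime] → ℕ)
    (hm : ∀ (ℓ : ℕ) [Fact ℓ.Prime], 1 ≤ m ℓ)
    (hmonic : ∀ (ℓ : ℕ) [Fact ℓ.Prime], (Q ℓ).Monic)
    (hQ0 : ∀ (ℓ : ℕ) [Fact ℓ.Prime], (Q ℓ).eval 0 ≠ 0)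
    (hdvd : ∀ (ℓ : ℕ) [Fact ℓ.Prime],
      Q ℓ ∣ Polynomial.map (algebraMap ℚ ℚ_[ℓ]) (P ^ m ℓ)) :
    ∀ᶠ ℓ in Filter.cofinite, ∀ [Fact ℓ.Prime], ‖(Q ℓ).eval 0‖ = 1 := by
  obtain ⟨c, n, R, hc, hR, hR0, hPR⟩ := exists_eq_C_mul_X_pow_mul_monic hP
  have hcoeff : ∀ᶠ ℓ in Filter.cofinite, ∀ i ∈ R.support, ∀ [Fact (Nat.Prime ℓ)],
      ‖(R.coeff i : ℚ_[ℓ])‖ ≤ 1 :=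
    (Filter.eventually_all_finset _).mpr fun i _ => eventually_norm_padic_rat_le_one _
  filter_upwards [hcoeff, eventually_norm_padic_rat_le_one (R.eval 0),
    eventually_norm_padic_rat_le_one (R.eval 0)⁻¹] with ℓ hℓ h0 h0inv _
  set φ := algebraMap ℚ ℚ_[ℓ]
  have heval : (R.map φ).eval 0 = (R.eval 0 : ℚ) := by
    rw [← Polynomial.coeff_zero_eq_eval_zero, Polynomial.coeff_map,
      Polynomial.coeff_zero_eq_eval_zero, eq_ratCast]
  refine norm_eval_zero_eq_one_of_dvd_pow (f := R.map φ) (m := m ℓ) (hR.map φ) (fun i => ?_) ?_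
    (hmonic ℓ) ?_
  · rw [Polynomial.coeff_map, eq_ratCast]
    by_cases hi : i ∈ R.support
    · exact hℓ i hi
    · simp [Polynomial.notMem_support_iff.mp hi]
  · rw [heval]
    have hne : ((R.eval 0 : ℚ) : ℚ_[ℓ]) ≠ 0 := by exact_mod_cast hR0
    refine le_antisymm h0 ?_
    have hinv := @h0inv _
    rw [Rat.cast_inv, norm_inv] at hinv
    exact (inv_le_one₀ (norm_pos_iff.mpr hne)).mp hinv
  · have hX : IsCoprime (Q ℓ) Polynomial.X := by
      refine ((Polynomial.irreducible_X.coprime_iff_not_dvd).mpr fun h => hQ0 ℓ ?_).symm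
      rwa [Polynomial.X_dvd_iff, Polynomial.coeff_zero_eq_eval_zero] at h
    have hC : IsCoprime (Q ℓ) (Polynomial.C (φ c)) := by
      refine ⟨0, Polynomial.C (φ c)⁻¹, ?_⟩
      rw [zero_mul, zero_add, ← Polynomial.C_mul, inv_mul_cancel₀ ((map_ne_zero φ).mpr hc),
        Polynomial.C_1]
    have h := hdvd ℓ
    rw [hPR, mul_pow, Polynomial.map_mul, Polynomial.map_pow, Polynomial.map_pow,
      Polynomial.map_mul, Polynomial.map_pow, Polynomial.map_C, Polynomial.map_X] at h
    exact (hC.mul_right hX.pow_right).pow_right.dvd_of_dvd_mul_left h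
end

section
/- Let k be a field of characteristic zero, let G be a finite group, let N be a finite-dimensional k-vector space with a k-linear G-action, let Z be a (possibly infinite-dimensional) k-vector space with a k-linear G-action, and let B : N × Z → k be a k-bilinear G-invariant pairing (B(g·n, g·z) = B(n, z)) whose left kernel is zero: if B(n, z) = 0 for all z ∈ Z then n = 0. Then there exists a finite-dimensional G-stable subspace W ⊆ Z such that the restriction of B to N × W is a perfect pairing, i.e. the induced linear maps N → Hom_k(W, k) and W → Hom_k(N, k) are both bijective. -/
/-- The average over a finite group `G` of a linear map `s : Dual k N → Z` under conjugation. -/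
noncomputable def LinearMap.dualAverage (k G : Type*) [Field k] [Group G] [Fintype G]
    {N Z : Type*} [AddCommGroup N] [Module k N] [AddCommGroup Z] [Module k Z]
    [DistribMulAction G N] [SMulCommClass G k N] [DistribMulAction G Z] [SMulCommClass G k Z]
    (s : Module.Dual k N →ₗ[k] Z) : Module.Dual k N →ₗ[k] Z :=
  (Fintype.card G : k)⁻¹ • ∑ g : G, DistribSMul.toLinearMap k Z g ∘ₗ s ∘ₗ
    (DistribSMul.toLinearMap k N g).dualMap

section DualAverage

variable {k G N Z : Type*} [Field k] [Group G] [Fintype G] [AddCommGroup N] [Module k N]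
  [AddCommGroup Z] [Module k Z] [DistribMulAction G N] [SMulCommClass G k N]
  [DistribMulAction G Z] [SMulCommClass G k Z]

theorem LinearMap.dualAverage_apply (s : Module.Dual k N →ₗ[k] Z) (f : Module.Dual k N) :
    s.dualAverage k G f = (Fintype.card G : k)⁻¹ •
      ∑ g : G, g • s (f ∘ₗ DistribSMul.toLinearMap k N g) := by
  simp only [dualAverage, smul_apply, sum_apply, comp_apply]
  rfl

theorem LinearMap.smul_dualAverage (s : Module.Dual k N →ₗ[k] Z) (h : G) (f : Module.Dual k N) :
    h • s.dualAverage k G f = s.dualAverage k G (f ∘ₗ DistribSMul.toLinearMap k N h⁻¹) := by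
  rw [dualAverage_apply, dualAverage_apply, smul_comm, Finset.smul_sum]
  congr 1
  refine Fintype.sum_equiv (Equiv.mulLeft h) _ _ fun g => ?_
  rw [Equiv.coe_mulLeft, mul_smul]
  congr 3
  ext n
  simp [smul_smul]

/-- Averaging preserves the sections of the map `Z → Dual k N` given by an invariant pairing. -/
theorem LinearMap.apply_dualAverage_of_invariant [CharZero k] (B : N →ₗ[k] Z →ₗ[k] k)
    (hB : ∀ (g : G) (n : N) (z : Z), B (g • n) (g • z) = B n z)
    {s : Module.Dual k N →ₗ[k] Z} (hs : ∀ n f, B n (s f) = f n) (n : N) (f : Module.Dual k N) :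
    B n (s.dualAverage k G f) = f n := by
  have key (g : G) : B n (g • s (f ∘ₗ DistribSMul.toLinearMap k N g)) = f n := by
    rw [← hB g⁻¹, inv_smul_smul, hs]
    simp
  simp [dualAverage_apply, key]

end DualAverage

theorem stmt_8 {k : Type} [Field k] [CharZero k] {G : Type} [Group G] [Finite G]
    {N Z : Type} [AddCommGroup N] [Module k N] [FiniteDimensional k N]
    [AddCommGroup Z] [Module k Z]
    [DistribMulAction G N] [SMulCommClass G k N]
    [DistribMulAction G Z] [SMulCommClass G k Z]
    (B : N →ₗ[k] Z →ₗ[k] k)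
    (hBG : ∀ (g : G) (n : N) (z : Z), B (g • n) (g • z) = B n z)
    (hleft : ∀ n : N, (∀ z : Z, B n z = 0) → n = 0) :
    ∃ W : Submodule k Z, FiniteDimensional k W ∧
      (∀ (g : G), ∀ w ∈ W, g • w ∈ W) ∧
      Function.Bijective (fun n : N => (B n).domRestrict W) ∧
      Function.Bijective (fun w : W => B.flip (w : Z)) := by
  have := Fintype.ofFinite G
  have hflip : Function.Surjective B.flip :=
    LinearMap.flip_surjective_iff₁.mpr <| (injective_iff_map_eq_zero B).mpr fun n hn =>
      hleft n fun z => by simp [hn]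
  obtain ⟨s, hs⟩ := B.flip.exists_rightInverse_of_surjective (LinearMap.range_eq_top.mpr hflip)
  set t := s.dualAverage k G
  have ht : ∀ n f, B n (t f) = f n := LinearMap.apply_dualAverage_of_invariant B hBG
    fun n f => LinearMap.congr_fun (LinearMap.congr_fun hs f) n
  have htinj : Function.Injective t := fun f f' h => by
    ext n
    rw [← ht, h, ht]
  have hinj : Function.Injective fun n : N => (B n).domRestrict (LinearMap.range t) := by
    refine (injective_iff_map_eq_zero (LinearMap.domRestrict₂ B (LinearMap.range t))).mpr fun n hn =>
      (Module.forall_dual_apply_eq_zero_iff k n).mp fun f => ?_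
    rw [← ht]
    exact LinearMap.congr_fun hn ⟨t f, f, rfl⟩
  refine ⟨LinearMap.range t, inferInstance, ?_, ⟨hinj, ?_⟩, ?_, ?_⟩
  · rintro g _ ⟨f, rfl⟩
    exact ⟨_, (s.smul_dualAverage g f).symm⟩
  · refine (LinearMap.injective_iff_surjective_of_finrank_eq_finrank
      (f := B.domRestrict₂ (LinearMap.range t)) ?_).mp hinj
    rw [Subspace.dual_finrank_eq, LinearMap.finrank_range_of_inj htinj, Subspace.dual_finrank_eq]
  · rintro ⟨_, f, rfl⟩ ⟨_, f', rfl⟩ h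
    have : f = f' := by
      ext n
      rw [← ht, ← ht n f']
      exact LinearMap.congr_fun h n
    simp [this]
  · exact fun f => ⟨⟨t f, f, rfl⟩, LinearMap.ext fun n => ht n f⟩
end

section
/- Let A and B be finitely generated free ℤ-modules and let β : A × B → ℤ be a ℤ-bilinear pairing such that the induced ℚ-bilinear pairing (A ⊗ ℚ) × (B ⊗ ℚ) → ℚ is perfect (the induced map A ⊗ ℚ → Hom_ℚ(B ⊗ ℚ, ℚ) is bijective). Then there exists a positive integer N such that for every prime ℓ not dividing N and every integer n ≥ 1, the induced pairing (A/ℓⁿA) × (B/ℓⁿB) → ℤ/ℓⁿℤ is perfect, i.e. the induced maps A/ℓⁿA → Hom(B/ℓⁿB, ℤ/ℓⁿℤ) and B/ℓⁿB → Hom(A/ℓⁿA, ℤ/ℓⁿℤ) are bijective. -/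
/-- The reduction modulo `k` of a `ℤ`-bilinear pairing. -/
theorem exists_reduction {A B : Type*} [AddCommGroup A] [AddCommGroup B]
    (β : A →ₗ[ℤ] B →ₗ[ℤ] ℤ) {c : ℤ} {k : ℕ} (hc : c = k) :
    ∃ βbar : (A ⧸ LinearMap.range (c • (LinearMap.id : A →ₗ[ℤ] A))) →ₗ[ℤ]
        (B ⧸ LinearMap.range (c • (LinearMap.id : B →ₗ[ℤ] B))) →ₗ[ℤ] ZMod k,
      ∀ (a : A) (b : B),
        βbar (Submodule.Quotient.mk a) (Submodule.Quotient.mk b) = ((β a b : ℤ) : ZMod k) := by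
  have hcz : ((c : ℤ) : ZMod k) = 0 := by simp [hc]
  let red : A →ₗ[ℤ] (B ⧸ LinearMap.range (c • (LinearMap.id : B →ₗ[ℤ] B))) →ₗ[ℤ] ZMod k :=
    { toFun := fun a => Submodule.liftQ (LinearMap.range (c • (LinearMap.id : B →ₗ[ℤ] B)))
        ((Algebra.linearMap ℤ (ZMod k)).comp (β a)) (by
        rintro _ ⟨b, rfl⟩
        simp [hcz])
      map_add' := fun a a' => by
        ext b
        simp
      map_smul' := fun r a => by
        ext b
        simp }
  refine ⟨Submodule.liftQ _ red ?_, fun a b => rfl⟩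
  rintro _ ⟨a, rfl⟩
  rw [LinearMap.mem_ker]
  ext b
  change ((β (c • a) b : ℤ) : ZMod k) = 0
  simp [hcz]

/-- If `β : A → Hom(B, ℤ)` has a two-sided inverse up to multiplication by `N`, then any reduction
of `β` modulo an integer coprime to `N` is bijective. -/
theorem bijective_reduction {A B : Type*} [AddCommGroup A]
    [AddCommGroup B] [Module.Projective ℤ B]
    (β : A →ₗ[ℤ] B →ₗ[ℤ] ℤ) (γ : (B →ₗ[ℤ] ℤ) →ₗ[ℤ] A) {N c : ℤ} {k : ℕ} (hc : c = k)
    (hN : IsCoprime N c)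
    (hβγ : ∀ φ, β (γ φ) = N • φ) (hγβ : ∀ a, γ (β a) = N • a)
    (βbar : (A ⧸ LinearMap.range (c • (LinearMap.id : A →ₗ[ℤ] A))) →ₗ[ℤ]
        (B ⧸ LinearMap.range (c • (LinearMap.id : B →ₗ[ℤ] B))) →ₗ[ℤ] ZMod k)
    (h : ∀ (a : A) (b : B),
        βbar (Submodule.Quotient.mk a) (Submodule.Quotient.mk b) = ((β a b : ℤ) : ZMod k)) :
    Function.Bijective βbar := by
  obtain ⟨u, v, huv⟩ := hN
  constructor
  · rw [← LinearMap.ker_eq_bot, LinearMap.ker_eq_bot']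
    intro x hx
    obtain ⟨a, rfl⟩ := Submodule.Quotient.mk_surjective _ x
    have hdvd : ∀ b, c ∣ β a b := fun b => by
      have := h a b
      rw [hx, LinearMap.zero_apply] at this
      rw [hc]
      exact (ZMod.intCast_zmod_eq_zero_iff_dvd _ _).1 this.symm
    let ψ : B →ₗ[ℤ] ℤ :=
      { toFun := fun b => β a b / c
        map_add' := fun b b' => by
          rw [map_add, Int.add_ediv_of_dvd_left (hdvd b)]
        map_smul' := fun r b => by
          simp [Int.mul_ediv_assoc _ (hdvd b)] }
    have hψ : β a = c • ψ := by
      ext b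
      exact (Int.mul_ediv_cancel' (hdvd b)).symm
    have hNa : N • a = c • γ ψ := by rw [← hγβ, hψ, map_smul]
    rw [Submodule.Quotient.mk_eq_zero]
    refine ⟨u • γ ψ + v • a, ?_⟩
    calc c • (u • γ ψ + v • a) = u • (c • γ ψ) + (v * c) • a := by
          rw [smul_add, smul_comm c u, mul_comm v c, mul_smul]
      _ = a := by rw [← hNa, ← mul_smul, ← add_smul, huv, one_smul]
  · intro φ
    obtain ⟨ψ, hψ⟩ := Module.projective_lifting_property (Algebra.linearMap ℤ (ZMod k))
      (φ.comp (Submodule.mkQ (LinearMap.range (c • (LinearMap.id : B →ₗ[ℤ] B))))) (by exact ZMod.intCast_surjective)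
    refine ⟨Submodule.Quotient.mk (u • γ ψ), ?_⟩
    ext b
    have hb : ((ψ b : ℤ) : ZMod k) = φ (Submodule.Quotient.mk b) := LinearMap.congr_fun hψ b
    have huv' : ((u : ℤ) : ZMod k) * (N : ZMod k) = 1 := by
      have := congrArg (Int.cast : ℤ → ZMod k) huv
      simpa [hc] using this
    change βbar (Submodule.Quotient.mk _) (Submodule.Quotient.mk b) = φ (Submodule.Quotient.mk b)
    rw [h, map_smul, hβγ, ← hb]
    simp [← mul_assoc, huv']

/-- An injective linear map between finite free `ℤ`-modules of the same rank has a two-sided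
inverse up to multiplication by a positive integer. -/
theorem exists_inverse_up_to_mul {A D : Type*} [AddCommGroup A]
    [AddCommGroup D] [Module.Finite ℤ D] [Module.Free ℤ D]
    (f : A →ₗ[ℤ] D) (hf : Function.Injective f)
    (hrank : Module.finrank ℤ A = Module.finrank ℤ D) :
    ∃ N : ℕ, 0 < N ∧ ∃ γ : D →ₗ[ℤ] A,
      (∀ x, f (γ x) = (N : ℤ) • x) ∧ ∀ a, γ (f a) = (N : ℤ) • a := by
  have hfin : Finite (D ⧸ LinearMap.range f) := by
    apply Submodule.finiteQuotientOfFreeOfRankEq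
    rw [← hrank, LinearMap.finrank_range_of_inj hf]
  set N := Nat.card (D ⧸ LinearMap.range f)
  have hmem : ∀ x : D, (N : ℤ) • x ∈ LinearMap.range f := fun x => by
    rw [← Submodule.Quotient.mk_eq_zero, Submodule.Quotient.mk_smul]
    simp [N]
  let e := LinearEquiv.ofInjective f hf
  let γ : D →ₗ[ℤ] A := e.symm.toLinearMap.comp
    (((N : ℤ) • (LinearMap.id : D →ₗ[ℤ] D)).codRestrict (LinearMap.range f) hmem)
  have hγ : ∀ x, f (γ x) = (N : ℤ) • x := fun x =>
    congrArg Subtype.val (e.apply_symm_apply ⟨(N : ℤ) • x, hmem x⟩)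
  refine ⟨N, Nat.card_pos, γ, hγ, fun a => hf ?_⟩
  rw [hγ, map_smul]


open TensorProduct in
theorem stmt_9 {A B : Type} [AddCommGroup A] [Module ℤ A]
    [Module.Finite ℤ A] [Module.Free ℤ A]
    [AddCommGroup B] [Module ℤ B] [Module.Finite ℤ B] [Module.Free ℤ B]
    (β : A →ₗ[ℤ] B →ₗ[ℤ] ℤ)
    -- the induced `ℚ`-bilinear pairing on `(ℚ ⊗ A) × (ℚ ⊗ B)` is perfect
    (hperf : ∃ βQ : (ℚ ⊗[ℤ] A) →ₗ[ℚ] (ℚ ⊗[ℤ] B) →ₗ[ℚ] ℚ,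
      (∀ (a : A) (b : B), βQ ((1 : ℚ) ⊗ₜ[ℤ] a) ((1 : ℚ) ⊗ₜ[ℤ] b) = (β a b : ℚ)) ∧
      Function.Bijective βQ) :
    ∃ N : ℕ, 0 < N ∧ ∀ ℓ : ℕ, ℓ.Prime → ¬ (ℓ ∣ N) → ∀ n : ℕ, 1 ≤ n →
      -- the reduced pairing on `(A/ℓⁿA) × (B/ℓⁿB)` with values in `ℤ/ℓⁿℤ` is perfect
      ∃ βbar : (A ⧸ LinearMap.range ((ℓ : ℤ) ^ n • (LinearMap.id : A →ₗ[ℤ] A))) →ₗ[ℤ]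
          (B ⧸ LinearMap.range ((ℓ : ℤ) ^ n • (LinearMap.id : B →ₗ[ℤ] B))) →ₗ[ℤ]
          ZMod (ℓ ^ n),
        (∀ (a : A) (b : B),
          βbar (Submodule.Quotient.mk a) (Submodule.Quotient.mk b) = ((β a b : ℤ) : ZMod (ℓ ^ n))) ∧
        Function.Bijective βbar ∧ Function.Bijective βbar.flip := by
  obtain rfl : ‹Module ℤ A› = AddCommGroup.toIntModule A := Subsingleton.elim _ _
  obtain rfl : ‹Module ℤ B› = AddCommGroup.toIntModule B := Subsingleton.elim _ _
  obtain ⟨βQ, hβQ, hbij⟩ := hperf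
  have hinj : Function.Injective β := by
    rw [← LinearMap.ker_eq_bot, LinearMap.ker_eq_bot']
    intro a ha
    have h0 : βQ ((1 : ℚ) ⊗ₜ[ℤ] a) = 0 := by
      ext b
      simp [hβQ, ha]
    have h1 : (1 : ℚ) ⊗ₜ[ℤ] a = 0 := hbij.1 (h0.trans (map_zero βQ).symm)
    exact Module.Flat.tensorProduct_mk_injective ℤ A ℚ (h1.trans (TensorProduct.tmul_zero A 1).symm)
  have hrank : Module.finrank ℤ A = Module.finrank ℤ (B →ₗ[ℤ] ℤ) := by
    have h1 := (LinearEquiv.ofBijective βQ hbij).finrank_eq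
    have h2 := Subspace.dual_finrank_eq (K := ℚ) (V := ℚ ⊗[ℤ] B)
    rw [Module.finrank_linearMap, Module.finrank_self, mul_one]
    rw [← Module.finrank_baseChange (R := ℚ) (M' := A),
      ← Module.finrank_baseChange (R := ℚ) (M' := B)]
    exact h1.trans h2
  obtain ⟨N, hN, γ, hβγ, hγβ⟩ := exists_inverse_up_to_mul β hinj hrank
  refine ⟨N, hN, fun ℓ hℓ hℓN n _ => ?_⟩
  have hc : (ℓ : ℤ) ^ n = ((ℓ ^ n : ℕ) : ℤ) := by push_cast; rfl
  have hcop : IsCoprime (N : ℤ) ((ℓ : ℤ) ^ n) :=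
    (Nat.isCoprime_iff_coprime.2 ((hℓ.coprime_iff_not_dvd.2 hℓN).symm)).pow_right
  obtain ⟨βbar, h⟩ := exists_reduction β hc
  let ev := Module.evalEquiv ℤ B
  have hev : ∀ (φ : B →ₗ[ℤ] ℤ) (ξ : (B →ₗ[ℤ] ℤ) →ₗ[ℤ] ℤ), φ (ev.symm ξ) = ξ φ :=
    fun φ ξ => Module.apply_evalEquiv_symm_apply _ _ φ ξ
  refine ⟨βbar, h, bijective_reduction β γ hc hcop hβγ hγβ βbar h,
    bijective_reduction β.flip (ev.symm.toLinearMap.comp γ.dualMap) hc hcop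
      (fun φ => ?_) (fun b => ?_) βbar.flip fun b a => h a b⟩
  · ext a
    change β a (ev.symm (γ.dualMap φ)) = _
    rw [hev, LinearMap.dualMap_apply, hγβ, map_smul, LinearMap.smul_apply]
  · apply ev.injective
    change ev (ev.symm (γ.dualMap (β.flip b))) = _
    rw [LinearEquiv.apply_symm_apply]
    ext φ
    change β (γ φ) b = φ ((N : ℤ) • b)
    rw [hβγ, LinearMap.smul_apply, map_smul]
end
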